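/- Let N ≥ 3 be an integer, x₀ ∈ ℝ^N, d > 0, and let u, v be harmonic functions on the punctured ball B_d(x₀) \ {x₀} (twice continuously differentiable there with Δu = Δv = 0). Then the quantity P_θ(u,v) does not depend on θ for θ ∈ (0, d): for all θ₁, θ₂ ∈ (0, d), P_{θ₁}(u,v) = P_{θ₂}(u,v). -/

import Mathlib

open MeasureTheory Metric Real
open scoped RealInnerProductSpace ENNReal

/-- The Euclidean Laplacian `Δu = Σ_{i=1}^N ∂²u/∂x_i²` on `ℝ^N`. -/
noncomputable def laplacian {N : ℕ} (u : EuclideanSpace ℝ (Fin N) → ℝ)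
    (x : EuclideanSpace ℝ (Fin N)) : ℝ :=
  ∑ i : Fin N, fderiv ℝ (fun y => fderiv ℝ u y (EuclideanSpace.single i 1)) x
    (EuclideanSpace.single i 1)

/-- The quadratic boundary form
`P_θ(u,v) = -θ∫_{∂B_θ(x₀)} ⟨∇u,ν⟩⟨∇v,ν⟩ + (θ/2)∫ ⟨∇u,∇v⟩
  + ((2-N)/4)∫ ⟨∇u,ν⟩ v + ((2-N)/4)∫ ⟨∇v,ν⟩ u`,
where `ν(x) = (x-x₀)/θ` and integrals are over the sphere `∂B_θ(x₀)` with respect to the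
`(N-1)`-dimensional Hausdorff measure. -/
noncomputable def Pform {N : ℕ} (x₀ : EuclideanSpace ℝ (Fin N)) (θ : ℝ)
    (u v : EuclideanSpace ℝ (Fin N) → ℝ) : ℝ :=
  -θ * ∫ x in sphere x₀ θ,
      (⟪gradient u x, θ⁻¹ • (x - x₀)⟫) * (⟪gradient v x, θ⁻¹ • (x - x₀)⟫) ∂μH[(N : ℝ) - 1]
  + (θ / 2) * ∫ x in sphere x₀ θ,
      (⟪gradient u x, gradient v x⟫) ∂μH[(N : ℝ) - 1]
  + ((2 - (N : ℝ)) / 4) * ∫ x in sphere x₀ θ,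
      (⟪gradient u x, θ⁻¹ • (x - x₀)⟫) * v x ∂μH[(N : ℝ) - 1]
  + ((2 - (N : ℝ)) / 4) * ∫ x in sphere x₀ θ,
      (⟪gradient v x, θ⁻¹ • (x - x₀)⟫) * u x ∂μH[(N : ℝ) - 1]

/-- The quadratic boundary form
`Q_{θ,i}(u,v) = -∫_{∂B_θ(x₀)} ⟨∇v,ν⟩ ∂u/∂x_i - ∫ ⟨∇u,ν⟩ ∂v/∂x_i + ∫ ⟨∇u,∇v⟩ ν_i`,
where `ν(x) = (x-x₀)/θ` and integrals are over the sphere `∂B_θ(x₀)` with respect to the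
`(N-1)`-dimensional Hausdorff measure. -/
noncomputable def Qform {N : ℕ} (x₀ : EuclideanSpace ℝ (Fin N)) (θ : ℝ) (i : Fin N)
    (u v : EuclideanSpace ℝ (Fin N) → ℝ) : ℝ :=
  -(∫ x in sphere x₀ θ,
      (⟪gradient v x, θ⁻¹ • (x - x₀)⟫) * fderiv ℝ u x (EuclideanSpace.single i 1)
        ∂μH[(N : ℝ) - 1])
  - ∫ x in sphere x₀ θ,
      (⟪gradient u x, θ⁻¹ • (x - x₀)⟫) * fderiv ℝ v x (EuclideanSpace.single i 1)
        ∂μH[(N : ℝ) - 1]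
  + ∫ x in sphere x₀ θ,
      (⟪gradient u x, gradient v x⟫) * ((x - x₀) i / θ) ∂μH[(N : ℝ) - 1]

/-- The `(N-1)`-dimensional surface measure of the unit sphere in `ℝ^N`. -/
noncomputable def omegaN (N : ℕ) : ℝ :=
  (μH[(N : ℝ) - 1] (sphere (0 : EuclideanSpace ℝ (Fin N)) 1)).toReal

/-- The fundamental solution `S_{x₀}(x) = 1/((N-2) ω_N |x-x₀|^{N-2})` of `-Δ` with pole `x₀`. -/
noncomputable def fundSol {N : ℕ} (x₀ x : EuclideanSpace ℝ (Fin N)) : ℝ :=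
  1 / (((N : ℝ) - 2) * omegaN N * ‖x - x₀‖ ^ (N - 2))

/-- `W_{x₀,h}(x) = (x_h - (x₀)_h)/(ω_N |x-x₀|^N)`, the partial derivative of
`S_{x₀}(x)` with respect to the `h`-th coordinate of the pole `x₀`. -/
noncomputable def poleDeriv {N : ℕ} (x₀ : EuclideanSpace ℝ (Fin N)) (h : Fin N)
    (x : EuclideanSpace ℝ (Fin N)) : ℝ :=
  (x h - x₀ h) / (omegaN N * ‖x - x₀‖ ^ N)

section SphereMeasure

variable {E : Type*} [NormedAddCommGroup E] [InnerProductSpace ℝ E] [MeasurableSpace E]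
  [BorelSpace E]

theorem setIntegral_sphere_hausdorffMeasure (x₀ : E) {r s : ℝ} (hr : 0 < r) (hs : 0 ≤ s)
    (f : E → ℝ) :
    ∫ x in sphere x₀ r, f x ∂μH[s] = r ^ s * ∫ ω in sphere 0 1, f (x₀ + r • ω) ∂μH[s] := by
  let e : E ≃ₜ E := (Homeomorph.smulOfNeZero r hr.ne').trans (Homeomorph.addLeft x₀)
  have he (ω : E) : e ω = x₀ + r • ω := rfl
  have hmap : Measure.map e μH[s] = ‖r‖₊⁻¹ ^ s • (μH[s] : Measure E) := by
    rw [← map_homothety_hausdorffMeasure hs x₀ hr.ne',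
      ← (IsometryEquiv.addRight x₀).map_hausdorffMeasure s,
      Measure.map_map (AffineMap.homothety_continuous x₀ r).measurable
        (IsometryEquiv.addRight x₀).continuous.measurable,
      (IsometryEquiv.addRight x₀).map_hausdorffMeasure s]
    congr 1
    ext ω
    simp [he, AffineMap.homothety_apply, add_comm]
  have hpre : e ⁻¹' sphere x₀ r = sphere 0 1 := by
    ext ω
    simp [he, norm_smul, abs_of_pos hr, hr.ne']
  have key := e.measurableEmbedding.setIntegral_map (μ := μH[s]) f (sphere x₀ r)
  rw [hmap, hpre, Measure.restrict_smul, integral_smul_nnreal_measure] at key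
  have hrs : r ^ s * (‖r‖₊⁻¹ ^ s : NNReal) = 1 := by
    rw [NNReal.coe_rpow, NNReal.coe_inv, coe_nnnorm, norm_of_nonneg hr.le, inv_rpow hr.le]
    exact mul_inv_cancel₀ (rpow_pos_of_pos hr s).ne'
  change _ = r ^ s * ∫ ω in sphere 0 1, f (e ω) ∂μH[s]
  rw [← key, NNReal.smul_def, smul_eq_mul, ← mul_assoc, hrs, one_mul]

theorem measurePreserving_hausdorffMeasure_restrict_sphere (e : E ≃ₗᵢ[ℝ] E) (s : ℝ) :
    MeasurePreserving e (μH[s].restrict (sphere 0 1)) (μH[s].restrict (sphere 0 1)) := by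
  have h := (e.toIsometryEquiv.measurePreserving_hausdorffMeasure s).restrict_preimage
    (s := sphere (0 : E) 1) isClosed_sphere.measurableSet
  have hpre : e.toIsometryEquiv ⁻¹' sphere (0 : E) 1 = sphere 0 1 := by
    ext ω
    simp
  rwa [hpre] at h

end SphereMeasure

theorem hausdorffMeasure_sphere_lt_top (n : ℕ) :
    μH[(n : ℝ)] (sphere (0 : EuclideanSpace ℝ (Fin (n + 1))) 1) < ∞ := by
  let ins (i : Fin (n + 1)) (c : ℝ) (y : Fin n → ℝ) : EuclideanSpace ℝ (Fin (n + 1)) :=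
    WithLp.toLp 2 (i.insertNth c y)
  let f (p : Fin (n + 1) × Bool) (y : Fin n → ℝ) : EuclideanSpace ℝ (Fin (n + 1)) :=
    (‖ins p.1 (bif p.2 then 1 else -1) y‖)⁻¹ • ins p.1 (bif p.2 then 1 else -1) y
  let K : Set (Fin n → ℝ) := Set.Icc (-1) 1
  have hins (i : Fin (n + 1)) (c : ℝ) : ContDiff ℝ 1 (ins i c) := by
    rw [contDiff_euclidean]
    intro j
    induction j using i.succAboveCases with
    | x => simpa [ins] using contDiff_const
    | p j => simpa [ins] using contDiff_apply ℝ ℝ j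
  have hne (i : Fin (n + 1)) (c : ℝ) (hc : c ≠ 0) (y : Fin n → ℝ) : ins i c y ≠ 0 := by
    intro h
    apply hc
    simpa [ins] using congrArg (fun z : EuclideanSpace ℝ (Fin (n + 1)) => z i) h
  have hf (p : Fin (n + 1) × Bool) : ContDiff ℝ 1 (f p) := by
    have hc : (bif p.2 then 1 else -1 : ℝ) ≠ 0 := by cases p.2 <;> simp
    exact (((hins _ _).norm ℝ fun y => hne _ _ hc y).inv
      fun y => norm_ne_zero_iff.2 (hne _ _ hc y)).smul (hins _ _)
  have hcover : sphere (0 : EuclideanSpace ℝ (Fin (n + 1))) 1 ⊆ ⋃ p, f p '' K := by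
    intro x hx
    have hx1 : ‖x‖ = 1 := by simpa using hx
    obtain ⟨i, -, hi⟩ := Finset.exists_max_image Finset.univ (fun j => |x j|)
      Finset.univ_nonempty
    have hi0 : 0 < |x i| := by
      refine lt_of_le_of_ne (abs_nonneg _) fun h => ?_
      have : x = 0 := by
        ext j
        have := hi j (Finset.mem_univ j)
        rw [← h] at this
        simpa using this
      simp [this] at hx1
    have hmem : (fun j : Fin n => |x i|⁻¹ * x (i.succAbove j)) ∈ K := by
      rw [Set.mem_Icc, Pi.le_def, Pi.le_def, ← forall_and]
      intro j
      rw [Pi.neg_apply, Pi.one_apply, ← abs_le, abs_mul, abs_inv, abs_abs, inv_mul_le_iff₀ hi0,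
        mul_one]
      exact hi _ (Finset.mem_univ _)
    have hsign : (bif decide (0 < x i) then 1 else -1 : ℝ) = |x i|⁻¹ * x i := by
      rcases lt_or_gt_of_ne (abs_pos.1 hi0) with h | h
      · rw [abs_of_neg h, inv_neg, neg_mul, inv_mul_cancel₀ h.ne]
        simp [h.not_gt]
      · rw [abs_of_pos h, inv_mul_cancel₀ h.ne']
        simp [h]
    have hinsx : ins i (bif decide (0 < x i) then 1 else -1)
        (fun j : Fin n => |x i|⁻¹ * x (i.succAbove j)) = |x i|⁻¹ • x := by
      ext j
      induction j using i.succAboveCases with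
      | x => simpa [ins] using hsign
      | p j => simp [ins]
    refine Set.mem_iUnion.2 ⟨(i, decide (0 < x i)), _, hmem, ?_⟩
    simp only [f]
    rw [hinsx, norm_smul, hx1, mul_one, norm_inv, norm_eq_abs, abs_abs, inv_inv, smul_smul,
      mul_inv_cancel₀ hi0.ne', one_smul]
  refine (measure_mono hcover).trans_lt ((measure_iUnion_le _).trans_lt ?_)
  rw [tsum_fintype]
  refine ENNReal.sum_lt_top.2 fun p _ => ?_
  obtain ⟨C, hC⟩ := (hf p).contDiffOn.exists_lipschitzOnWith (s := K) one_ne_zero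
    (convex_Icc _ _) isCompact_Icc
  refine (hC.hausdorffMeasure_image_le n.cast_nonneg).trans_lt ?_
  refine ENNReal.mul_lt_top (ENNReal.rpow_lt_top_of_nonneg n.cast_nonneg ENNReal.coe_ne_top) ?_
  have hvol : (μH[(n : ℝ)] : Measure (Fin n → ℝ)) = volume := by
    simpa using hausdorffMeasure_pi_real (ι := Fin n)
  rw [hvol]
  exact isCompact_Icc.measure_lt_top

section Flux

variable {E : Type*} [NormedAddCommGroup E] [MeasurableSpace E] [BorelSpace E]

theorem hasDerivAt_setIntegral_of_continuousOn {μ : Measure E} {K : Set E} (hK : IsCompact K)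
    (hμ : μ K ≠ ∞) {g g' : ℝ → E → ℝ} {t₀ δ : ℝ} (hδ : 0 < δ)
    (hg : ∀ t ∈ closedBall t₀ δ, ContinuousOn (g t) K)
    (hg' : ContinuousOn (Function.uncurry g') (closedBall t₀ δ ×ˢ K))
    (hderiv : ∀ t ∈ closedBall t₀ δ, ∀ x ∈ K, HasDerivAt (g · x) (g' t x) t) :
    HasDerivAt (fun t => ∫ x in K, g t x ∂μ) (∫ x in K, g' t₀ x ∂μ) t₀ := by
  have ht₀ : t₀ ∈ closedBall t₀ δ := mem_closedBall_self hδ.le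
  have hinteg {f : E → ℝ} (hf : ContinuousOn f K) : IntegrableOn f K μ :=
    hf.integrableOn_of_subset_isCompact hK hK.measurableSet subset_rfl hμ
  obtain ⟨C, hC⟩ := ((isCompact_closedBall t₀ δ).prod hK).exists_bound_of_continuousOn hg'
  refine (hasDerivAt_integral_of_dominated_loc_of_deriv_le (bound := fun _ => C)
    (closedBall_mem_nhds t₀ hδ) ?_ (hinteg (hg t₀ ht₀)) ?_ ?_ (hinteg continuousOn_const) ?_).2
  · filter_upwards [closedBall_mem_nhds t₀ hδ] with t ht
    exact (hinteg (hg t ht)).aestronglyMeasurable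
  · refine (hinteg (hg'.comp (f := fun x => (t₀, x)) ?_ ?_)).aestronglyMeasurable
    · exact (Continuous.prodMk_right t₀).continuousOn
    · exact fun x hx => ⟨ht₀, hx⟩
  · refine (ae_restrict_mem hK.measurableSet).mono fun x hx t ht => hC (t, x) ⟨ht, hx⟩
  · exact (ae_restrict_mem hK.measurableSet).mono fun x hx t ht => hderiv t ht x hx

variable [InnerProductSpace ℝ E] [FiniteDimensional ℝ E]

theorem setIntegral_sphere_fderiv_apply_skew {μ : Measure E} (hμ : μ (sphere 0 1) ≠ ∞)
    (hinv : ∀ e : E ≃ₗᵢ[ℝ] E,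
      MeasurePreserving e (μ.restrict (sphere 0 1)) (μ.restrict (sphere 0 1)))
    {Ω : Set E} (hΩ : IsOpen Ω) (hSΩ : sphere 0 1 ⊆ Ω) {G : E → ℝ} (hG : ContDiffOn ℝ 1 G Ω)
    (A : E →L[ℝ] E) (hA : ∀ x y, ⟪A x, y⟫ = -⟪x, A y⟫) :
    ∫ ω in sphere 0 1, fderiv ℝ G ω (A ω) ∂μ = 0 := by
  have hAskew : A ∈ skewAdjoint (E →L[ℝ] E) := by
    rw [skewAdjoint.mem_iff, ContinuousLinearMap.star_eq_adjoint, eq_comm,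
      ContinuousLinearMap.eq_adjoint_iff]
    intro x y
    simp [hA]
  let : NormedAlgebra ℚ (E →L[ℝ] E) := NormedAlgebra.restrictScalars ℚ ℝ _
  have hunit (t : ℝ) : NormedSpace.exp (t • A) ∈ unitary (E →L[ℝ] E) :=
    NormedSpace.exp_mem_unitary_of_mem_skewAdjoint (skewAdjoint.smul_mem t hAskew)
  let e (t : ℝ) : E ≃ₗᵢ[ℝ] E := Unitary.linearIsometryEquiv ⟨_, hunit t⟩
  have he (t : ℝ) (x : E) : e t x = NormedSpace.exp (t • A) x := rfl
  have hmem (t : ℝ) {x : E} (hx : x ∈ sphere (0 : E) 1) : e t x ∈ sphere (0 : E) 1 := by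
    simpa using hx
  have hexp (t : ℝ) := hasDerivAt_exp_smul_const' (𝕂 := ℝ) A t
  have hcont : Continuous fun p : ℝ × E => e p.1 p.2 := by
    have : Continuous fun t : ℝ => NormedSpace.exp (t • A) :=
      continuous_iff_continuousAt.2 fun t => (hexp t).continuousAt
    simp only [he]
    fun_prop
  have hG' : ContinuousOn (fderiv ℝ G) Ω := hG.continuousOn_fderiv_of_isOpen hΩ le_rfl
  have hderiv : HasDerivAt (fun t => ∫ ω in sphere 0 1, G (e t ω) ∂μ)
      (∫ ω in sphere 0 1, fderiv ℝ G (e 0 ω) (A (e 0 ω)) ∂μ) 0 := by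
    refine hasDerivAt_setIntegral_of_continuousOn (isCompact_sphere 0 1) hμ one_pos
      (g' := fun t ω => fderiv ℝ G (e t ω) (A (e t ω))) ?_ ?_ ?_
    · exact fun t _ => hG.continuousOn.comp (e t).continuous.continuousOn
        fun ω hω => hSΩ (hmem t hω)
    · refine ContinuousOn.clm_apply (hG'.comp hcont.continuousOn
        fun p hp => hSΩ (hmem p.1 hp.2)) (A.continuous.comp hcont).continuousOn
    · intro t _ ω hω
      have h1 : HasDerivAt (fun t => e t ω) (A (e t ω)) t := by
        simpa [he] using (hexp t).clm_apply (hasDerivAt_const t ω)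
      exact ((hG.differentiableOn one_ne_zero).differentiableAt
        (hΩ.mem_nhds (hSΩ (hmem t hω)))).hasFDerivAt.comp_hasDerivAt t h1
  have hconst (t : ℝ) : ∫ ω in sphere 0 1, G (e t ω) ∂μ = ∫ ω in sphere 0 1, G ω ∂μ :=
    (hinv (e t)).integral_comp (e t).toHomeomorph.measurableEmbedding G
  simp only [hconst] at hderiv
  have := hderiv.unique (hasDerivAt_const _ _)
  simpa [he] using this

theorem setIntegral_sphere_divergence {ι : Type*} [Fintype ι] (b : OrthonormalBasis ι ℝ E)
    {μ : Measure E} (hμ : μ (sphere 0 1) ≠ ∞)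
    (hinv : ∀ e : E ≃ₗᵢ[ℝ] E,
      MeasurePreserving e (μ.restrict (sphere 0 1)) (μ.restrict (sphere 0 1)))
    {Ω : Set E} (hΩ : IsOpen Ω) (hSΩ : sphere 0 1 ⊆ Ω) {H : E → E} (hH : ContDiffOn ℝ 1 H Ω) :
    ∫ ω in sphere 0 1, (∑ i, ⟪b i, fderiv ℝ H ω (b i)⟫ - (Fintype.card ι - 1) * ⟪ω, H ω⟫
      - ⟪ω, fderiv ℝ H ω ω⟫) ∂μ = 0 := by
  classical
  let A (i j : ι) : E →L[ℝ] E :=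
    (innerSL ℝ (b i)).smulRight (b j) - (innerSL ℝ (b j)).smulRight (b i)
  have hAapply (i j : ι) (x : E) : A i j x = ⟪b i, x⟫ • b j - ⟪b j, x⟫ • b i := by
    simp [A]
  let G (i j : ι) (x : E) : ℝ := ⟪b i, x⟫ * ⟪b j, H x⟫
  have hG (i j : ι) : ContDiffOn ℝ 1 (G i j) Ω :=
    (contDiff_const.inner ℝ contDiff_id).contDiffOn.mul (contDiffOn_const.inner ℝ hH)
  have hG' (i j : ι) : ContinuousOn (fderiv ℝ (G i j)) Ω :=
    (hG i j).continuousOn_fderiv_of_isOpen hΩ le_rfl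
  have hzero (i j : ι) : ∫ ω in sphere 0 1, fderiv ℝ (G i j) ω (A i j ω) ∂μ = 0 := by
    refine setIntegral_sphere_fderiv_apply_skew hμ hinv hΩ hSΩ (hG i j) (A i j) fun x y => ?_
    simp only [hAapply, inner_sub_left, inner_sub_right, real_inner_smul_left,
      real_inner_smul_right, real_inner_comm x]
    ring
  have hinteg (i j : ι) :
      IntegrableOn (fun ω => fderiv ℝ (G i j) ω (A i j ω)) (sphere 0 1) μ := by
    refine ContinuousOn.integrableOn_of_subset_isCompact ?_ (isCompact_sphere 0 1)
      isClosed_sphere.measurableSet subset_rfl hμ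
    exact ((hG' i j).mono hSΩ).clm_apply (A i j).continuous.continuousOn
  have hpt : ∀ ω ∈ sphere (0 : E) 1,
      ∑ i, ⟪b i, fderiv ℝ H ω (b i)⟫ - (Fintype.card ι - 1) * ⟪ω, H ω⟫ - ⟪ω, fderiv ℝ H ω ω⟫
        = ∑ i, ∑ j, fderiv ℝ (G i j) ω (A i j ω) := by
    intro ω hω
    have hHω : DifferentiableAt ℝ H ω :=
      (hH.differentiableOn one_ne_zero).differentiableAt (hΩ.mem_nhds (hSΩ hω))
    have hnorm : ∑ i, ⟪b i, ω⟫ * ⟪b i, ω⟫ = 1 := by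
      have := b.sum_inner_mul_inner ω ω
      simp only [real_inner_comm _ ω] at this
      rw [this, real_inner_self_eq_norm_sq, mem_sphere_zero_iff_norm.1 hω, one_pow]
    have hfd (i j : ι) : fderiv ℝ (G i j) ω (A i j ω) =
        (if i = j then ⟪b i, ω⟫ * ⟪b i, H ω⟫ else 0) - ⟪b j, ω⟫ * ⟪b j, H ω⟫
          + ⟪b i, ω⟫ * ⟪b i, ω⟫ * ⟪b j, fderiv ℝ H ω (b j)⟫
          - ⟪b j, ω⟫ * (⟪b i, ω⟫ * ⟪b j, fderiv ℝ H ω (b i)⟫) := by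
      have h1 : HasFDerivAt (fun x : E => ⟪b i, x⟫) (innerSL ℝ (b i)) ω :=
        (innerSL ℝ (b i)).hasFDerivAt
      have h2 : HasFDerivAt (fun x : E => ⟪b j, H x⟫) ((innerSL ℝ (b j)).comp (fderiv ℝ H ω)) ω :=
        (innerSL ℝ (b j)).hasFDerivAt.comp ω hHω.hasFDerivAt
      rw [show fderiv ℝ (G i j) ω = _ from (h1.mul h2).fderiv]
      simp only [add_apply, smul_apply, innerSL_apply_apply, ContinuousLinearMap.comp_apply,
        hAapply, map_sub, map_smul, smul_eq_mul, b.inner_eq_ite]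
      split_ifs with h
      · subst h
        ring
      · simp
        ring
    have hsum (i : ι) : ∑ j, ⟪b j, ω⟫ * (⟪b i, ω⟫ * ⟪b j, fderiv ℝ H ω (b i)⟫)
        = ⟪b i, ω⟫ * ⟪ω, fderiv ℝ H ω (b i)⟫ := by
      rw [← b.sum_inner_mul_inner ω, Finset.mul_sum]
      refine Finset.sum_congr rfl fun j _ => ?_
      rw [real_inner_comm ω]
      ring
    have hinner : ∑ j, ⟪b j, ω⟫ * ⟪b j, H ω⟫ = ⟪ω, H ω⟫ := by
      rw [← b.sum_inner_mul_inner ω]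
      exact Finset.sum_congr rfl fun j _ => by rw [real_inner_comm ω]
    have hquad : ∑ i, ⟪b i, ω⟫ * ⟪ω, fderiv ℝ H ω (b i)⟫ = ⟪ω, fderiv ℝ H ω ω⟫ := by
      have hDω : fderiv ℝ H ω ω = ∑ i, ⟪b i, ω⟫ • fderiv ℝ H ω (b i) := by
        conv_lhs => arg 2; rw [← b.sum_repr' ω]
        simp
      simp only [hDω, inner_sum, real_inner_smul_right]
    simp only [hfd, Finset.sum_add_distrib, Finset.sum_sub_distrib, hsum, hquad, hinner,
      Finset.sum_ite_eq, Finset.mem_univ, if_true, ← Finset.mul_sum, ← Finset.sum_mul, hnorm,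
      Finset.sum_const, Finset.card_univ, nsmul_eq_mul]
    ring
  rw [setIntegral_congr_fun isClosed_sphere.measurableSet hpt,
    integral_finsetSum _ fun i _ => integrable_finsetSum _ fun j _ => hinteg i j]
  refine Finset.sum_eq_zero fun i _ => ?_
  rw [integral_finsetSum _ fun j _ => hinteg i j]
  exact Finset.sum_eq_zero fun j _ => hzero i j

theorem hasDerivAt_flux {ι : Type*} [Fintype ι] (b : OrthonormalBasis ι ℝ E) {n : ℕ}
    (hn : Fintype.card ι = n + 1) {μ : Measure E} (hμ : μ (sphere 0 1) ≠ ∞)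
    (hinv : ∀ e : E ≃ₗᵢ[ℝ] E,
      MeasurePreserving e (μ.restrict (sphere 0 1)) (μ.restrict (sphere 0 1)))
    {x₀ : E} {d : ℝ} {F : E → E} (hF : ContDiffOn ℝ 1 F (ball x₀ d \ {x₀}))
    (hdiv : ∀ x ∈ ball x₀ d \ {x₀}, ∑ i, ⟪b i, fderiv ℝ F x (b i)⟫ = 0)
    {r : ℝ} (hr : r ∈ Set.Ioo 0 d) :
    HasDerivAt (fun r => r ^ n * ∫ ω in sphere 0 1, ⟪ω, F (x₀ + r • ω)⟫ ∂μ) 0 r := by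
  have hΩ : IsOpen (ball x₀ d \ {x₀}) := isOpen_ball.sdiff isClosed_singleton
  have hmem {t : ℝ} (ht : t ∈ Set.Ioo 0 d) {ω : E} (hω : ω ∈ sphere (0 : E) 1) :
      x₀ + t • ω ∈ ball x₀ d \ {x₀} := by
    have hω0 : ω ≠ 0 := ne_zero_of_mem_unit_sphere ⟨ω, hω⟩
    rw [mem_sphere_zero_iff_norm] at hω
    simp [norm_smul, hω, abs_of_pos ht.1, ht.1.ne', ht.2, hω0]
  have hFd {x : E} (hx : x ∈ ball x₀ d \ {x₀}) : HasFDerivAt F (fderiv ℝ F x) x :=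
    ((hF.differentiableOn one_ne_zero).differentiableAt (hΩ.mem_nhds hx)).hasFDerivAt
  have hF' : ContinuousOn (fderiv ℝ F) (ball x₀ d \ {x₀}) :=
    hF.continuousOn_fderiv_of_isOpen hΩ le_rfl
  have hinteg {f : E → ℝ} (hf : ContinuousOn f (sphere 0 1)) : IntegrableOn f (sphere 0 1) μ :=
    hf.integrableOn_of_subset_isCompact (isCompact_sphere 0 1) isClosed_sphere.measurableSet
      subset_rfl hμ
  obtain ⟨δ, hδ, hδr⟩ := nhds_basis_closedBall.mem_iff.1 (isOpen_Ioo.mem_nhds hr)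
  have hcont (t : ℝ) (ht : t ∈ Set.Ioo 0 d) :
      ContinuousOn (fun ω => ⟪ω, F (x₀ + t • ω)⟫) (sphere 0 1) :=
    continuousOn_id.inner
      (hF.continuousOn.comp (by fun_prop) fun ω hω => hmem ht hω)
  have hcont' : ContinuousOn (Function.uncurry fun t ω => ⟪ω, fderiv ℝ F (x₀ + t • ω) ω⟫)
      (Set.Ioo 0 d ×ˢ sphere 0 1) :=
    continuousOn_snd.inner (ContinuousOn.clm_apply
      (hF'.comp (f := fun p : ℝ × E => x₀ + p.1 • p.2) (by fun_prop)
        fun p hp => hmem hp.1 hp.2) continuousOn_snd)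
  have hcont'r : ContinuousOn (fun ω => ⟪ω, fderiv ℝ F (x₀ + r • ω) ω⟫) (sphere 0 1) :=
    hcont'.comp (f := fun ω : E => (r, ω)) (Continuous.prodMk_right r).continuousOn
      fun ω hω => ⟨hr, hω⟩
  have hderiv : HasDerivAt (fun r => ∫ ω in sphere 0 1, ⟪ω, F (x₀ + r • ω)⟫ ∂μ)
      (∫ ω in sphere 0 1, ⟪ω, fderiv ℝ F (x₀ + r • ω) ω⟫ ∂μ) r := by
    refine hasDerivAt_setIntegral_of_continuousOn (isCompact_sphere 0 1) hμ hδ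
      (g' := fun t ω => ⟪ω, fderiv ℝ F (x₀ + t • ω) ω⟫)
      (fun t ht => hcont t (hδr ht)) (hcont'.mono (Set.prod_mono_left hδr)) fun t ht ω hω => ?_
    have h1 : HasDerivAt (fun t : ℝ => x₀ + t • ω) ω t := by
      simpa using ((hasDerivAt_id t).smul_const ω).const_add x₀
    simpa using (hasDerivAt_const t ω).inner ℝ
      ((hFd (hmem (hδr ht) hω)).comp_hasDerivAt t h1)
  have hpre : IsOpen ((fun ω : E => x₀ + r • ω) ⁻¹' (ball x₀ d \ {x₀})) :=
    hΩ.preimage (by fun_prop)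
  have hsph := setIntegral_sphere_divergence b hμ hinv hpre (fun ω hω => hmem hr hω)
    (H := fun ω => F (x₀ + r • ω))
    (hF.comp (by fun_prop) fun ω hω => hω)
  have hpt : ∀ ω ∈ sphere (0 : E) 1,
      ∑ i, ⟪b i, fderiv ℝ (fun ω => F (x₀ + r • ω)) ω (b i)⟫
        - (Fintype.card ι - 1) * ⟪ω, F (x₀ + r • ω)⟫
        - ⟪ω, fderiv ℝ (fun ω => F (x₀ + r • ω)) ω ω⟫
      = -(n * ⟪ω, F (x₀ + r • ω)⟫ + r * ⟪ω, fderiv ℝ F (x₀ + r • ω) ω⟫) := by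
    intro ω hω
    have h1 : HasFDerivAt (fun ω : E => x₀ + r • ω) (r • ContinuousLinearMap.id ℝ E) ω :=
      ((hasFDerivAt_id ω).const_smul r).const_add x₀
    rw [show fderiv ℝ (fun ω => F (x₀ + r • ω)) ω = _ from
      ((hFd (hmem hr hω)).comp ω h1).fderiv]
    simp only [ContinuousLinearMap.comp_apply, smul_apply,
      ContinuousLinearMap.id_apply, map_smul, real_inner_smul_right, ← Finset.mul_sum,
      hdiv _ (hmem hr hω), hn]
    push_cast
    ring
  rw [setIntegral_congr_fun isClosed_sphere.measurableSet hpt, integral_neg,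
    integral_add ((hinteg (hcont r hr)).const_mul _) ((hinteg hcont'r).const_mul _),
    integral_const_mul, integral_const_mul, neg_eq_zero] at hsph
  refine ((hasDerivAt_pow n r).mul hderiv).congr_deriv ?_
  cases n with
  | zero =>
    have := hr.1.ne'
    simp_all
  | succ m =>
    rw [Nat.add_sub_cancel, pow_succ]
    linear_combination r ^ m * hsph

end Flux

section PohozaevField

variable {E : Type*} [NormedAddCommGroup E] [InnerProductSpace ℝ E] [FiniteDimensional ℝ E]

theorem gradient_eq_sum {ι : Type*} [Fintype ι] (b : OrthonormalBasis ι ℝ E) (u : E → ℝ) (x : E) :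
    gradient u x = ∑ i, fderiv ℝ u x (b i) • b i := by
  rw [← b.sum_repr' (gradient u x)]
  refine Finset.sum_congr rfl fun i _ => ?_
  rw [real_inner_comm, inner_gradient_left]

theorem ContDiffOn.gradient_of_isOpen {u : E → ℝ} {Ω : Set E} (hu : ContDiffOn ℝ 2 u Ω)
    (hΩ : IsOpen Ω) : ContDiffOn ℝ 1 (gradient u) Ω := by
  have h1 : ContDiffOn ℝ 1 (fderiv ℝ u) Ω := hu.fderiv_of_isOpen hΩ (by norm_num)
  have h2 : gradient u = fun x => ∑ i, fderiv ℝ u x (stdOrthonormalBasis ℝ E i) •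
      stdOrthonormalBasis ℝ E i := funext fun x => gradient_eq_sum _ u x
  rw [h2]
  exact ContDiffOn.sum fun i _ => (h1.clm_apply contDiffOn_const).smul contDiffOn_const

theorem inner_fderiv_gradient {u : E → ℝ} {x : E} (hu : DifferentiableAt ℝ (gradient u) x)
    (h k : E) : ⟪k, fderiv ℝ (gradient u) x h⟫ = fderiv ℝ (fun y => fderiv ℝ u y k) x h := by
  have h1 : (fun y => fderiv ℝ u y k) = fun y => ⟪k, gradient u y⟫ := by
    ext y
    rw [real_inner_comm, inner_gradient_left]
  rw [h1, show fderiv ℝ (fun y => ⟪k, gradient u y⟫) x = _ from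
    ((innerSL ℝ k).hasFDerivAt.comp x hu.hasFDerivAt).fderiv]
  simp

theorem inner_fderiv_gradient_comm {u : E → ℝ} {x : E} (hu : ContDiffAt ℝ 2 u x)
    (hg : DifferentiableAt ℝ (gradient u) x) (h k : E) :
    ⟪k, fderiv ℝ (gradient u) x h⟫ = ⟪h, fderiv ℝ (gradient u) x k⟫ := by
  have hd : DifferentiableAt ℝ (fderiv ℝ u) x :=
    (hu.fderiv_right (m := 1) (by norm_num)).differentiableAt one_ne_zero
  have hfd (h k : E) : fderiv ℝ (fun y => fderiv ℝ u y k) x h = fderiv ℝ (fderiv ℝ u) x h k := by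
    rw [fderiv_clm_apply hd (differentiableAt_const k)]
    simp
  rw [inner_fderiv_gradient hg, inner_fderiv_gradient hg, hfd, hfd]
  exact hu.isSymmSndFDerivAt (by simp) h k

/-- The vector field whose flux through `∂B_θ(x₀)` is `P_θ(u, v)` when `c = (2 - N) / 4`. -/
noncomputable def pohozaevField (c : ℝ) (x₀ : E) (u v : E → ℝ) (x : E) : E :=
  (-(1 / 2) * ⟪gradient u x, x - x₀⟫) • gradient v x
    + (-(1 / 2) * ⟪gradient v x, x - x₀⟫) • gradient u x
    + ((1 / 2) * ⟪gradient u x, gradient v x⟫) • (x - x₀)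
    + ((c * v x) • gradient u x + (c * u x) • gradient v x)

theorem contDiffOn_pohozaevField {c : ℝ} {x₀ : E} {u v : E → ℝ} {Ω : Set E} (hΩ : IsOpen Ω)
    (hu : ContDiffOn ℝ 2 u Ω) (hv : ContDiffOn ℝ 2 v Ω) :
    ContDiffOn ℝ 1 (pohozaevField c x₀ u v) Ω := by
  have hgu := hu.gradient_of_isOpen hΩ
  have hgv := hv.gradient_of_isOpen hΩ
  have hu1 : ContDiffOn ℝ 1 u Ω := hu.of_le (by norm_num)
  have hv1 : ContDiffOn ℝ 1 v Ω := hv.of_le (by norm_num)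
  have hy : ContDiffOn ℝ 1 (fun x => x - x₀) Ω := contDiffOn_id.sub contDiffOn_const
  have hc {a : ℝ} : ContDiffOn ℝ 1 (fun _ : E => a) Ω := contDiffOn_const
  exact ((((hc.mul (hgu.inner ℝ hy)).smul hgv).add ((hc.mul (hgv.inner ℝ hy)).smul hgu)).add
    ((hc.mul (hgu.inner ℝ hgv)).smul hy)).add
    (((hc.mul hv1).smul hgu).add ((hc.mul hu1).smul hgv))

theorem divergence_pohozaevField {ι : Type*} [Fintype ι] (b : OrthonormalBasis ι ℝ E) {c : ℝ}
    (hc : c = (2 - Fintype.card ι) / 4) (x₀ : E) {u v : E → ℝ} {x : E}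
    (hu : ContDiffAt ℝ 2 u x) (hv : ContDiffAt ℝ 2 v x)
    (hgu : DifferentiableAt ℝ (gradient u) x) (hgv : DifferentiableAt ℝ (gradient v) x)
    (hu0 : ∑ i, ⟪b i, fderiv ℝ (gradient u) x (b i)⟫ = 0)
    (hv0 : ∑ i, ⟪b i, fderiv ℝ (gradient v) x (b i)⟫ = 0) :
    ∑ i, ⟪b i, fderiv ℝ (pohozaevField c x₀ u v) x (b i)⟫ = 0 := by
  have hud := (hu.differentiableAt two_ne_zero).hasFDerivAt
  have hvd := (hv.differentiableAt two_ne_zero).hasFDerivAt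
  have hy : HasFDerivAt (fun x => x - x₀) (ContinuousLinearMap.id ℝ E) x :=
    (hasFDerivAt_id x).sub_const x₀
  have hF := ((((hgu.hasFDerivAt.inner ℝ hy).const_mul (-(1 / 2))).smul hgv.hasFDerivAt).add
    (((hgv.hasFDerivAt.inner ℝ hy).const_mul (-(1 / 2))).smul hgu.hasFDerivAt)).add
    (((hgu.hasFDerivAt.inner ℝ hgv.hasFDerivAt).const_mul (1 / 2)).smul hy) |>.add
    (((hvd.const_mul c).smul hgu.hasFDerivAt).add ((hud.const_mul c).smul hgv.hasFDerivAt))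
  rw [show fderiv ℝ (pohozaevField c x₀ u v) x = _ from hF.fderiv]
  have hsu := inner_fderiv_gradient_comm hu hgu
  have hsv := inner_fderiv_gradient_comm hv hgv
  have hfu (k : E) : fderiv ℝ u x k = ⟪gradient u x, k⟫ := inner_gradient_left.symm
  have hfv (k : E) : fderiv ℝ v x k = ⟪gradient v x, k⟫ := inner_gradient_left.symm
  set gu := gradient u x
  set gv := gradient v x
  set A := fderiv ℝ (gradient u) x
  set B := fderiv ℝ (gradient v) x
  set y := x - x₀
  have hterm (i : ι) : ⟪b i, ((-(1 / 2) * ⟪gu, y⟫) • B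
        + (-(1 / 2 : ℝ) • (fderivInnerCLM ℝ (gu, y)).comp
            (A.prod (ContinuousLinearMap.id ℝ E))).smulRight gv
        + ((-(1 / 2) * ⟪gv, y⟫) • A
        + (-(1 / 2 : ℝ) • (fderivInnerCLM ℝ (gv, y)).comp
            (B.prod (ContinuousLinearMap.id ℝ E))).smulRight gu)
        + ((1 / 2 * ⟪gu, gv⟫) • ContinuousLinearMap.id ℝ E
        + ((1 / 2 : ℝ) • (fderivInnerCLM ℝ (gu, gv)).comp (A.prod B)).smulRight y)
        + ((c * v x) • A + (c • fderiv ℝ v x).smulRight gu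
        + ((c * u x) • B + (c • fderiv ℝ u x).smulRight gv))) (b i)⟫
      = (c * u x - 1 / 2 * ⟪gu, y⟫) * ⟪b i, B (b i)⟫
        + (c * v x - 1 / 2 * ⟪gv, y⟫) * ⟪b i, A (b i)⟫
        + (c - 1 / 2) * (⟪gu, b i⟫ * ⟪b i, gv⟫) + (c - 1 / 2) * (⟪gv, b i⟫ * ⟪b i, gu⟫)
        - 1 / 2 * (⟪A y, b i⟫ * ⟪b i, gv⟫) - 1 / 2 * (⟪B y, b i⟫ * ⟪b i, gu⟫)
        + 1 / 2 * (⟪A gv, b i⟫ * ⟪b i, y⟫) + 1 / 2 * (⟪B gu, b i⟫ * ⟪b i, y⟫)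
        + 1 / 2 * ⟪gu, gv⟫ := by
    have hbb : ⟪b i, b i⟫ = (1 : ℝ) := by simp
    have hA (w : E) : ⟪A (b i), w⟫ = ⟪A w, b i⟫ := by
      rw [real_inner_comm, hsu, real_inner_comm]
    have hB (w : E) : ⟪w, B (b i)⟫ = ⟪B w, b i⟫ := by
      rw [hsv, real_inner_comm]
    simp only [add_apply, smul_apply, ContinuousLinearMap.smulRight_apply,
      ContinuousLinearMap.comp_apply, ContinuousLinearMap.prod_apply, fderivInnerCLM_apply,
      ContinuousLinearMap.id_apply, inner_add_right, real_inner_smul_right, smul_eq_mul, hfu, hfv,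
      hbb, hA, real_inner_comm y (B (b i)), hB gu, hB y]
    ring
  simp only [hterm, Finset.sum_add_distrib, Finset.sum_sub_distrib, ← Finset.mul_sum, hu0, hv0,
    b.sum_inner_mul_inner, Finset.sum_const, Finset.card_univ, nsmul_eq_mul]
  have hAsymm : ⟪A gv, y⟫ = ⟪A y, gv⟫ := by
    rw [real_inner_comm, hsu, real_inner_comm]
  have hBsymm : ⟪B gu, y⟫ = ⟪B y, gu⟫ := by
    rw [real_inner_comm, hsv, real_inner_comm]
  rw [hAsymm, hBsymm, real_inner_comm gu gv, hc]
  ring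

end PohozaevField

theorem Pform_eq_flux {n : ℕ} (x₀ : EuclideanSpace ℝ (Fin (n + 1))) {d θ : ℝ}
    (hθ : θ ∈ Set.Ioo 0 d) {u v : EuclideanSpace ℝ (Fin (n + 1)) → ℝ}
    (hu : ContDiffOn ℝ 2 u (ball x₀ d \ {x₀})) (hv : ContDiffOn ℝ 2 v (ball x₀ d \ {x₀})) :
    Pform x₀ θ u v = θ ^ n * ∫ ω in sphere 0 1,
      ⟪ω, pohozaevField ((2 - ((n + 1 : ℕ) : ℝ)) / 4) x₀ u v (x₀ + θ • ω)⟫ ∂μH[(n : ℝ)] := by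
  have hΩ : IsOpen (ball x₀ d \ {x₀}) := isOpen_ball.sdiff isClosed_singleton
  have hmaps : Set.MapsTo (fun ω => x₀ + θ • ω) (sphere 0 1) (ball x₀ d \ {x₀}) := by
    intro ω hω
    have hω0 : ω ≠ 0 := ne_zero_of_mem_unit_sphere ⟨ω, hω⟩
    rw [mem_sphere_zero_iff_norm] at hω
    simp [norm_smul, hω, abs_of_pos hθ.1, hθ.1.ne', hθ.2, hω0]
  have hcomp {Y : Type} [TopologicalSpace Y] {f : EuclideanSpace ℝ (Fin (n + 1)) → Y}
      (hf : ContinuousOn f (ball x₀ d \ {x₀})) :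
      ContinuousOn (fun ω => f (x₀ + θ • ω)) (sphere 0 1) :=
    hf.comp (by fun_prop) hmaps
  have hinteg {f : EuclideanSpace ℝ (Fin (n + 1)) → ℝ} (hf : ContinuousOn f (sphere 0 1)) :
      IntegrableOn f (sphere 0 1) μH[(n : ℝ)] :=
    hf.integrableOn_of_subset_isCompact (isCompact_sphere 0 1) isClosed_sphere.measurableSet
      subset_rfl (hausdorffMeasure_sphere_lt_top n).ne
  have hgu := hcomp (hu.gradient_of_isOpen hΩ).continuousOn
  have hgv := hcomp (hv.gradient_of_isOpen hΩ).continuousOn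
  have hcu := hcomp hu.continuousOn
  have hcv := hcomp hv.continuousOn
  have hN : ((n + 1 : ℕ) : ℝ) - 1 = n := by push_cast; ring
  have hν (ω : EuclideanSpace ℝ (Fin (n + 1))) : θ⁻¹ • (x₀ + θ • ω - x₀) = ω := by
    rw [add_sub_cancel_left, smul_smul, inv_mul_cancel₀ hθ.1.ne', one_smul]
  unfold Pform
  simp only [hN, setIntegral_sphere_hausdorffMeasure x₀ hθ.1 n.cast_nonneg, hν, rpow_natCast]
  have hguω : ContinuousOn (fun ω => ⟪gradient u (x₀ + θ • ω), ω⟫) (sphere 0 1) :=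
    hgu.inner continuousOn_id
  have hgvω : ContinuousOn (fun ω => ⟪gradient v (x₀ + θ • ω), ω⟫) (sphere 0 1) :=
    hgv.inner continuousOn_id
  have hpt (ω : EuclideanSpace ℝ (Fin (n + 1))) (hω : ω ∈ sphere 0 1) :
      ⟪ω, pohozaevField ((2 - ((n + 1 : ℕ) : ℝ)) / 4) x₀ u v (x₀ + θ • ω)⟫ =
        -θ * (⟪gradient u (x₀ + θ • ω), ω⟫ * ⟪gradient v (x₀ + θ • ω), ω⟫)
        + θ / 2 * ⟪gradient u (x₀ + θ • ω), gradient v (x₀ + θ • ω)⟫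
        + (2 - ((n + 1 : ℕ) : ℝ)) / 4 * (⟪gradient u (x₀ + θ • ω), ω⟫ * v (x₀ + θ • ω))
        + (2 - ((n + 1 : ℕ) : ℝ)) / 4 * (⟪gradient v (x₀ + θ • ω), ω⟫ * u (x₀ + θ • ω)) := by
    have hωω : ⟪ω, ω⟫ = (1 : ℝ) := by
      rw [real_inner_self_eq_norm_sq, mem_sphere_zero_iff_norm.1 hω, one_pow]
    rw [real_inner_comm]
    simp only [pohozaevField, add_sub_cancel_left, inner_add_left, real_inner_smul_left,
      real_inner_smul_right, hωω]
    ring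
  have h1 := (hinteg (f := fun ω => ⟪gradient u (x₀ + θ • ω), ω⟫ * ⟪gradient v (x₀ + θ • ω), ω⟫)
    (hguω.mul hgvω)).const_mul (-θ)
  have h2 := (hinteg (f := fun ω => ⟪gradient u (x₀ + θ • ω), gradient v (x₀ + θ • ω)⟫)
    (hgu.inner hgv)).const_mul (θ / 2)
  have h3 := (hinteg (f := fun ω => ⟪gradient u (x₀ + θ • ω), ω⟫ * v (x₀ + θ • ω))
    (hguω.mul hcv)).const_mul ((2 - ((n + 1 : ℕ) : ℝ)) / 4)
  have h4 := (hinteg (f := fun ω => ⟪gradient v (x₀ + θ • ω), ω⟫ * u (x₀ + θ • ω))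
    (hgvω.mul hcu)).const_mul ((2 - ((n + 1 : ℕ) : ℝ)) / 4)
  rw [setIntegral_congr_fun isClosed_sphere.measurableSet hpt,
    integral_add (by exact (h1.add h2).add h3) h4, integral_add (by exact h1.add h2) h3,
    integral_add h1 h2]
  simp only [integral_const_mul]
  ring

/-- If `u` and `v` are harmonic on the punctured ball `B_d(x₀) \ {x₀}`, then the quadratic
form `P_θ(u,v)` is independent of `θ ∈ (0, d)`. -/
theorem Pform_independent_of_radius {N : ℕ} (hN : 3 ≤ N)
    (x₀ : EuclideanSpace ℝ (Fin N)) (d : ℝ) (hd : 0 < d)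
    (u v : EuclideanSpace ℝ (Fin N) → ℝ)
    (hu : ContDiffOn ℝ 2 u (ball x₀ d \ {x₀}))
    (hv : ContDiffOn ℝ 2 v (ball x₀ d \ {x₀}))
    (hu0 : ∀ x ∈ ball x₀ d \ {x₀}, laplacian u x = 0)
    (hv0 : ∀ x ∈ ball x₀ d \ {x₀}, laplacian v x = 0) :
    ∀ θ₁ ∈ Set.Ioo (0 : ℝ) d, ∀ θ₂ ∈ Set.Ioo (0 : ℝ) d,
      Pform x₀ θ₁ u v = Pform x₀ θ₂ u v := by
  obtain ⟨n, rfl⟩ : ∃ n, N = n + 1 := ⟨N - 1, by lia⟩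
  have hΩ : IsOpen (ball x₀ d \ {x₀}) := isOpen_ball.sdiff isClosed_singleton
  let b := EuclideanSpace.basisFun (Fin (n + 1)) ℝ
  have htrace {w : EuclideanSpace ℝ (Fin (n + 1)) → ℝ} {x : EuclideanSpace ℝ (Fin (n + 1))}
      (hw : DifferentiableAt ℝ (gradient w) x) (hw0 : laplacian w x = 0) :
      ∑ i, ⟪b i, fderiv ℝ (gradient w) x (b i)⟫ = 0 := by
    simpa only [inner_fderiv_gradient hw, b, EuclideanSpace.basisFun_apply, laplacian] using hw0
  have hderiv (r : ℝ) (hr : r ∈ Set.Ioo 0 d) :=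
    hasDerivAt_flux b (n := n) (by simp) (hausdorffMeasure_sphere_lt_top n).ne
      (fun e => measurePreserving_hausdorffMeasure_restrict_sphere e n)
      (contDiffOn_pohozaevField (c := (2 - ((n + 1 : ℕ) : ℝ)) / 4) (x₀ := x₀) hΩ hu hv)
      (fun x hx => by
        have hnhds := hΩ.mem_nhds hx
        have hgu := ((hu.gradient_of_isOpen hΩ).contDiffAt hnhds).differentiableAt one_ne_zero
        have hgv := ((hv.gradient_of_isOpen hΩ).contDiffAt hnhds).differentiableAt one_ne_zero
        exact divergence_pohozaevField b (by simp) x₀ (hu.contDiffAt hnhds) (hv.contDiffAt hnhds)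
          hgu hgv (htrace hgu (hu0 x hx)) (htrace hgv (hv0 x hx))) hr
  intro θ₁ hθ₁ θ₂ hθ₂
  rw [Pform_eq_flux x₀ hθ₁ hu hv, Pform_eq_flux x₀ hθ₂ hu hv]
  exact isOpen_Ioo.is_const_of_deriv_eq_zero isPreconnected_Ioo
    (fun r hr => (hderiv r hr).differentiableAt.differentiableWithinAt)
    (fun r hr => (hderiv r hr).deriv) hθ₁ hθ₂
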